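/- Let Ω ⊆ ℝ^d be measurable, J : ℝ^d → ℝ be nonnegative and measurable, A > 0, c_L ∈ ℝ, and let h : ℝ → ℝ be Lipschitz with constant L_h. Let c, φ : Ω → ℝ be measurable with finite nonlocal seminorms |c|_V < ∞ and |φ|_V < ∞, and set μ(x) := 2A [ c(x) − (1−c_L) h(φ(x)) − c_L ] (the KKS chemical potential ∂_c f(φ,c)). Then the semicoercivity estimate (μ, c)_V ≥ A |c|_V² − A (1−c_L)² L_h² |φ|_V² holds, where (u,v)_V := (1/2) ∬_{Ω×Ω} J(x−y)[u(x)−u(y)][v(x)−v(y)] d(x,y) and |u|_V² := (u,u)_V. -/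

import Mathlib

open MeasureTheory

/-- semicoercivity (property (F4)) of the KKS chemical potential
`μ = ∂_c f(φ,c) = 2A[c − (1−c_L)h(φ) − c_L]`: for a nonnegative measurable kernel,
`h` Lipschitz with constant `L_h`, and `c, φ` measurable with finite nonlocal
seminorms, one has `(μ, c)_V ≥ A |c|_V² − A (1−c_L)² L_h² |φ|_V²`. -/
theorem kks_semicoercivity (d : ℕ)
    (Ω : Set (EuclideanSpace ℝ (Fin d))) (hΩ : MeasurableSet Ω)
    (J : EuclideanSpace ℝ (Fin d) → ℝ)
    (hJnonneg : ∀ z, 0 ≤ J z) (hJmeas : Measurable J)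
    (A cL : ℝ) (hA : 0 < A)
    (h : ℝ → ℝ) (Lh : ℝ) (hLh : 0 ≤ Lh)
    (hlip : ∀ a b : ℝ, |h a - h b| ≤ Lh * |a - b|)
    (c φ : EuclideanSpace ℝ (Fin d) → ℝ)
    (hc : Measurable c) (hφ : Measurable φ)
    (hcV : IntegrableOn
      (fun p : EuclideanSpace ℝ (Fin d) × EuclideanSpace ℝ (Fin d) =>
        J (p.1 - p.2) * (c p.1 - c p.2) ^ 2) (Ω ×ˢ Ω))
    (hφV : IntegrableOn
      (fun p : EuclideanSpace ℝ (Fin d) × EuclideanSpace ℝ (Fin d) =>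
        J (p.1 - p.2) * (φ p.1 - φ p.2) ^ 2) (Ω ×ˢ Ω))
    (μ : EuclideanSpace ℝ (Fin d) → ℝ)
    (hμ : μ = fun x => 2 * A * (c x - (1 - cL) * h (φ x) - cL)) :
    (1 / 2 : ℝ) * (∫ p in Ω ×ˢ Ω, J (p.1 - p.2) * (μ p.1 - μ p.2) * (c p.1 - c p.2)) ≥
      A * ((1 / 2 : ℝ) * ∫ p in Ω ×ˢ Ω, J (p.1 - p.2) * (c p.1 - c p.2) ^ 2) -
        A * (1 - cL) ^ 2 * Lh ^ 2 *
          ((1 / 2 : ℝ) * ∫ p in Ω ×ˢ Ω, J (p.1 - p.2) * (φ p.1 - φ p.2) ^ 2) := by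
  have hsq : ∀ x y, ((1 - cL) * (h (φ x) - h (φ y))) ^ 2 ≤
      (1 - cL) ^ 2 * Lh ^ 2 * (φ x - φ y) ^ 2 := by
    intro x y
    have h1 : (h (φ x) - h (φ y)) ^ 2 ≤ Lh ^ 2 * (φ x - φ y) ^ 2 := by
      rw [← mul_pow]
      apply sq_le_sq.mpr
      rw [abs_mul, abs_of_nonneg hLh]
      exact hlip _ _
    rw [mul_pow, mul_assoc]
    exact mul_le_mul_of_nonneg_left h1 (sq_nonneg _)
  have hdiff : ∀ x y, μ x - μ y =
      2 * A * ((c x - c y) - (1 - cL) * (h (φ x) - h (φ y))) := by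
    intro x y
    rw [hμ]
    ring
  have hcont : Continuous h := by
    have : LipschitzWith (Real.toNNReal Lh) h := by
      apply LipschitzWith.of_dist_le_mul
      intro a b
      rw [Real.coe_toNNReal _ hLh, Real.dist_eq, Real.dist_eq]
      exact hlip a b
    exact this.continuous
  have hhm : Measurable (fun x => h (φ x)) := hcont.measurable.comp hφ
  have hμm : Measurable μ := by
    rw [hμ]
    exact (((hc.sub (hhm.const_mul _)).sub_const _).const_mul _)
  have hint : IntegrableOn
      (fun p : EuclideanSpace ℝ (Fin d) × EuclideanSpace ℝ (Fin d) =>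
        J (p.1 - p.2) * (μ p.1 - μ p.2) * (c p.1 - c p.2)) (Ω ×ˢ Ω) := by
    refine Integrable.mono' ((hcV.const_mul (3 * A)).add
      (hφV.const_mul (A * ((1 - cL) ^ 2 * Lh ^ 2)))) ?_ ?_
    · apply Measurable.aestronglyMeasurable
      exact ((hJmeas.comp (measurable_fst.sub measurable_snd)).mul
        ((hμm.comp measurable_fst).sub (hμm.comp measurable_snd))).mul
        ((hc.comp measurable_fst).sub (hc.comp measurable_snd))
    · refine Filter.Eventually.of_forall fun p => ?_
      have hs := hsq p.1 p.2
      have hJ := hJnonneg (p.1 - p.2)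
      simp only [Pi.add_apply]
      rw [hdiff, Real.norm_eq_abs, mul_assoc, abs_mul, abs_of_nonneg hJ]
      generalize (1 - cL) * (h (φ p.1) - h (φ p.2)) = s at *
      generalize c p.1 - c p.2 = a at *
      have key : |2 * A * (a - s) * a| ≤
          3 * A * a ^ 2 + A * ((1 - cL) ^ 2 * Lh ^ 2 * (φ p.1 - φ p.2) ^ 2) := by
        have h2 := mul_le_mul_of_nonneg_left hs hA.le
        have h3 := mul_nonneg hA.le (sq_nonneg (a - s))
        have h4 := mul_nonneg hA.le (sq_nonneg (a + s))
        have h5 := mul_nonneg hA.le (sq_nonneg a)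
        rw [abs_le]
        constructor <;> nlinarith
      have := mul_le_mul_of_nonneg_left key hJ
      linarith
  have hmono := integral_mono ((hcV.const_mul A).sub
      (hφV.const_mul (A * ((1 - cL) ^ 2 * Lh ^ 2)))) hint (by
    intro p
    have hs := hsq p.1 p.2
    have hJ := hJnonneg (p.1 - p.2)
    simp only [Pi.sub_apply]
    rw [hdiff]
    generalize (1 - cL) * (h (φ p.1) - h (φ p.2)) = s at *
    generalize c p.1 - c p.2 = a at *
    have key : A * a ^ 2 - A * ((1 - cL) ^ 2 * Lh ^ 2 * (φ p.1 - φ p.2) ^ 2) ≤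
        2 * A * (a - s) * a := by
      have h2 := mul_le_mul_of_nonneg_left hs hA.le
      have h3 := mul_nonneg hA.le (sq_nonneg (a - s))
      nlinarith
    have := mul_le_mul_of_nonneg_left key hJ
    linarith)
  simp only [Pi.sub_apply] at hmono
  rw [integral_sub (hcV.const_mul A) (hφV.const_mul (A * ((1 - cL) ^ 2 * Lh ^ 2))),
    integral_const_mul, integral_const_mul] at hmono
  linarith
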